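/- Let (P, d, μ) be a metric measure space where μ is a σ-finite Borel regular measure such that every open ball has finite positive measure, and μ is doubling. Let p ∈ [1,∞) and let φ be quasi-concave. Then there is a constant C > 0, depending only on the doubling constant and p, such that for every μ-measurable u and every measurable set E with μ(E) < ∞: sup_{t>0} ((M_p u)·χ_E)*(t)·φ(t) ≤ C·(1 + μ(E)) · sup_{0<t<1} A_p u*(t)·φ(t). -/

import Mathlib

open MeasureTheory
open scoped ENNReal NNReal

/-- The non-centered Hardy–Littlewood-type maximal operator
`M_p u (x) = sup_{B ∋ x} ((1/μ B) ∫_B u^p dμ)^{1/p}`, the supremum being taken over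
open balls containing `x`. -/
noncomputable def maximalFn {P : Type*} [PseudoMetricSpace P] [MeasurableSpace P]
    (μ : Measure P) (p : ℝ) (u : P → ℝ≥0∞) (x : P) : ℝ≥0∞ :=
  ⨆ (c : P) (r : ℝ) (_ : 0 < r) (_ : x ∈ Metric.ball c r),
    ((μ (Metric.ball c r))⁻¹ * ∫⁻ z in Metric.ball c r, u z ^ p ∂μ) ^ (1 / p)

/-- The decreasing rearrangement `u*(t) = inf {s : μ {|u| > s} ≤ t}` of `u` (given here
for the modulus `u : P → [0,∞]` of a measurable function). -/
noncomputable def rearr {P : Type*} [MeasurableSpace P] (μ : Measure P)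
    (u : P → ℝ≥0∞) (t : ℝ) : ℝ≥0∞ :=
  sInf {s : ℝ≥0∞ | μ {x | s < u x} ≤ ENNReal.ofReal t}

/-- The elementary maximal function `u**(t) = (1/t) ∫₀^t u*(s) ds`. -/
noncomputable def doubleStar {P : Type*} [MeasurableSpace P] (μ : Measure P)
    (u : P → ℝ≥0∞) (t : ℝ) : ℝ≥0∞ :=
  (ENNReal.ofReal t)⁻¹ * ∫⁻ s in Set.Ioo (0 : ℝ) t, rearr μ u s

/-- The maximal average `A_p f (t) = ((1/t) ∫₀^t f(s)^p ds)^{1/p}`. -/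
noncomputable def Ap (p : ℝ) (f : ℝ → ℝ≥0∞) (t : ℝ) : ℝ≥0∞ :=
  ((ENNReal.ofReal t)⁻¹ * ∫⁻ s in Set.Ioo (0 : ℝ) t, f s ^ p) ^ (1 / p)

/-- A function `φ : [0,∞) → [0,∞)` is quasi-concave. -/
def QuasiConcave (φ : ℝ → ℝ) : Prop :=
  φ 0 = 0 ∧ (∀ t : ℝ, 0 < t → 0 < φ t) ∧ MonotoneOn φ (Set.Ici 0) ∧
    AntitoneOn (fun t => φ t / t) (Set.Ioi 0)

theorem rearr_le_iff {P : Type*} [MeasurableSpace P] {μ : Measure P} {u : P → ℝ≥0∞} {t : ℝ}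
    {s : ℝ≥0∞} : rearr μ u t ≤ s ↔ μ {x | s < u x} ≤ ENNReal.ofReal t := by
  refine ⟨fun h => ?_, fun h => sInf_le h⟩
  refine (measure_mono fun x (hx : s < u x) => h.trans_lt hx).trans ?_
  have hne : {s : ℝ≥0∞ | μ {x | s < u x} ≤ ENNReal.ofReal t}.Nonempty := ⟨⊤, by simp⟩
  obtain ⟨v, hv, hlim, hmem⟩ := exists_seq_tendsto_sInf hne (OrderBot.bddBelow _)
  have hsub : {x | rearr μ u t < u x} ⊆ ⋃ n, {x | v n < u x} := fun x hx =>
    Set.mem_iUnion.2 (hlim.eventually (gt_mem_nhds hx)).exists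
  have hmono : Monotone fun n => {x | v n < u x} := fun m n hmn x hx =>
    (hv hmn).trans_lt hx
  exact (measure_mono hsub).trans (hmono.measure_iUnion.trans_le (iSup_le hmem))

theorem lt_rearr_iff {P : Type*} [MeasurableSpace P] {μ : Measure P} {u : P → ℝ≥0∞} {t : ℝ}
    {s : ℝ≥0∞} : s < rearr μ u t ↔ ENNReal.ofReal t < μ {x | s < u x} := by
  rw [← not_le, rearr_le_iff, not_le]

theorem rearr_antitone {P : Type*} [MeasurableSpace P] (μ : Measure P) (u : P → ℝ≥0∞) :
    Antitone (rearr μ u) := fun _ _ h =>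
  rearr_le_iff.2 ((rearr_le_iff.1 le_rfl).trans (ENNReal.ofReal_le_ofReal h))

theorem rearr_mono {P : Type*} [MeasurableSpace P] (μ : Measure P) {u v : P → ℝ≥0∞}
    (h : u ≤ v) (t : ℝ) : rearr μ u t ≤ rearr μ v t :=
  rearr_le_iff.2 ((measure_mono fun x hx => lt_of_lt_of_le hx (h x)).trans
    (rearr_le_iff.1 le_rfl))

theorem rearr_indicator_eq_zero {P : Type*} [MeasurableSpace P] {μ : Measure P} {E : Set P}
    (u : P → ℝ≥0∞) {t : ℝ} (h : μ E ≤ ENNReal.ofReal t) : rearr μ (E.indicator u) t = 0 := by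
  refine le_antisymm (rearr_le_iff.2 ((measure_mono fun x (hx : 0 < E.indicator u x) => ?_).trans h))
    zero_le
  exact Set.mem_of_indicator_ne_zero (ne_of_gt hx)

theorem volume_Ioi_inter_ofReal_lt (y : ℝ≥0∞) :
    volume ({l : ℝ | ENNReal.ofReal l < y} ∩ Set.Ioi 0) = y := by
  by_cases hy : y = ⊤
  · simp [hy]
  · have : {l : ℝ | ENNReal.ofReal l < y} ∩ Set.Ioi 0 = Set.Ioo 0 y.toReal := by
      ext l
      constructor
      · rintro ⟨h, hl⟩
        exact ⟨hl, (ENNReal.ofReal_lt_iff_lt_toReal (le_of_lt hl) hy).1 h⟩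
      · rintro ⟨hl, h⟩
        exact ⟨(ENNReal.ofReal_lt_iff_lt_toReal hl.le hy).2 h, hl⟩
    rw [this, Real.volume_Ioo, sub_zero, ENNReal.ofReal_toReal hy]

/-- The layer cake formula for extended nonnegative functions. -/
theorem lintegral_eq_lintegral_measure_ofReal_lt {P : Type*} [MeasurableSpace P] (μ : Measure P)
    [SFinite μ] {f : P → ℝ≥0∞} (hf : Measurable f) :
    ∫⁻ x, f x ∂μ = ∫⁻ l in Set.Ioi (0 : ℝ), μ {x | ENNReal.ofReal l < f x} := by
  have hS : MeasurableSet {z : P × ℝ | ENNReal.ofReal z.2 < f z.1} :=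
    measurableSet_lt (by fun_prop) (by fun_prop)
  have hswap := lintegral_lintegral_swap (μ := μ) (ν := volume.restrict (Set.Ioi (0 : ℝ)))
    (f := fun x l => {z : P × ℝ | ENNReal.ofReal z.2 < f z.1}.indicator 1 (x, l))
    (measurable_one.indicator hS).aemeasurable
  have hl (x : P) : ∫⁻ l in Set.Ioi (0 : ℝ),
      {z : P × ℝ | ENNReal.ofReal z.2 < f z.1}.indicator 1 (x, l) = f x := by
    have hm : MeasurableSet {l : ℝ | ENNReal.ofReal l < f x} :=
      measurableSet_lt (by fun_prop) (by fun_prop)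
    calc _ = ∫⁻ l in Set.Ioi (0 : ℝ), {l : ℝ | ENNReal.ofReal l < f x}.indicator 1 l := rfl
      _ = _ := by
        rw [lintegral_indicator_one hm, Measure.restrict_apply hm, volume_Ioi_inter_ofReal_lt]
  have hr (l : ℝ) : ∫⁻ x, {z : P × ℝ | ENNReal.ofReal z.2 < f z.1}.indicator 1 (x, l) ∂μ =
      μ {x | ENNReal.ofReal l < f x} := by
    have hm : MeasurableSet {x | ENNReal.ofReal l < f x} :=
      measurableSet_lt (by fun_prop) (by fun_prop)
    exact lintegral_indicator_one hm
  simpa only [hl, hr] using hswap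

theorem lintegral_indicator_rpow_le_lintegral_rearr {P : Type*} [MeasurableSpace P]
    {μ : Measure P} [SFinite μ] {p : ℝ} (hp : 0 < p) {u : P → ℝ≥0∞} (hu : Measurable u)
    {t : ℝ} {a : ℝ≥0∞} (ha : μ {x | a < u x} ≤ ENNReal.ofReal t) :
    ∫⁻ x, {x | a < u x}.indicator (fun x => u x ^ p) x ∂μ ≤
      ∫⁻ s in Set.Ioo (0 : ℝ) t, rearr μ u s ^ p := by
  have hm : MeasurableSet {x | a < u x} := measurableSet_lt (by fun_prop) (by fun_prop)
  have hr : Measurable fun s => rearr μ u s ^ p :=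
    (rearr_antitone μ u).measurable.pow_const p
  rw [lintegral_eq_lintegral_measure_ofReal_lt μ ((hu.pow_const p).indicator hm),
    lintegral_eq_lintegral_measure_ofReal_lt _ hr]
  refine lintegral_mono fun l => ?_
  set k := ENNReal.ofReal l ^ p⁻¹
  have hlt (y : ℝ≥0∞) : ENNReal.ofReal l < y ^ p ↔ k < y := (ENNReal.rpow_inv_lt_iff hp).symm
  simp only [hlt]
  have hms : MeasurableSet {s : ℝ | k < rearr μ u s} :=
    measurableSet_lt measurable_const (rearr_antitone μ u).measurable
  rw [Measure.restrict_apply hms]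
  calc μ {x | ENNReal.ofReal l < {x | a < u x}.indicator (fun x => u x ^ p) x}
      ≤ min (μ {x | k < u x}) (ENNReal.ofReal t) := by
        have hmem {x : P} (hx : ENNReal.ofReal l <
            {x | a < u x}.indicator (fun x => u x ^ p) x) : a < u x ∧ k < u x := by
          have hxa : x ∈ {x | a < u x} := Set.mem_of_indicator_ne_zero (ne_bot_of_gt hx)
          rw [Set.indicator_of_mem hxa, hlt] at hx
          exact ⟨hxa, hx⟩
        exact le_min (measure_mono fun x hx => (hmem hx).2)
          ((measure_mono fun x hx => (hmem hx).1).trans ha)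
    _ = volume ({s : ℝ | ENNReal.ofReal s < min (μ {x | k < u x}) (ENNReal.ofReal t)} ∩
          Set.Ioi 0) := (volume_Ioi_inter_ofReal_lt _).symm
    _ ≤ _ := by
        refine measure_mono ?_
        rintro s ⟨hs : ENNReal.ofReal s < min _ _, hs0⟩
        obtain ⟨h1, h2⟩ := lt_min_iff.1 hs
        exact ⟨lt_rearr_iff.2 h1, hs0, ((ENNReal.ofReal_lt_ofReal_iff_of_nonneg hs0.le).1 h2)⟩

section WeakType

variable {P : Type*} [PseudoMetricSpace P] [MeasurableSpace P] [BorelSpace P] {μ : Measure P}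
  [SigmaFinite μ] {K : ℝ≥0∞}

theorem mul_measure_bounded_radius_le (hpos : ∀ (x : P) (r : ℝ), 0 < r → 0 < μ (Metric.ball x r))
    (hK : ∀ (x : P) (r : ℝ), 0 < r → μ (Metric.ball x (8 * r)) ≤ K * μ (Metric.ball x r))
    (v : P → ℝ≥0∞) (l : ℝ≥0∞) (R : ℝ) :
    l * μ {x | ∃ c r, 0 < r ∧ r ≤ R ∧ x ∈ Metric.ball c r ∧
      l * μ (Metric.ball c r) ≤ ∫⁻ z in Metric.ball c r, v z ∂μ} ≤ K * ∫⁻ z, v z ∂μ := by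
  let B : P × ℝ → Set P := fun i => Metric.ball i.1 i.2
  let T : Set (P × ℝ) := {i | 0 < i.2 ∧ i.2 ≤ R ∧ l * μ (B i) ≤ ∫⁻ z in B i, v z ∂μ}
  obtain ⟨S, hST, hdisj, hcov⟩ := Vitali.exists_disjoint_subfamily_covering_enlargement B T
    (fun i => i.2) 2 one_lt_two (fun i hi => hi.1.le) R (fun i hi => hi.2.1)
    (fun i hi => Metric.nonempty_ball.2 hi.1)
  have hcount : S.Countable := by
    have := Measure.countable_meas_pos_of_disjoint_iUnion (μ := μ) (As := fun i : S => B i)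
      (fun i => Metric.isOpen_ball.measurableSet) (fun i j hij =>
        hdisj i.2 j.2 (Subtype.coe_injective.ne hij))
    have huniv : {i : S | 0 < μ (B i)} = Set.univ :=
      Set.eq_univ_of_forall fun i => hpos _ _ (hST i.2).1
    rw [huniv, Set.countable_univ_iff] at this
    exact this
  have hsub : {x | ∃ c r, 0 < r ∧ r ≤ R ∧ x ∈ Metric.ball c r ∧
      l * μ (Metric.ball c r) ≤ ∫⁻ z in Metric.ball c r, v z ∂μ} ⊆
      ⋃ i ∈ S, Metric.ball i.1 (8 * i.2) := by
    rintro x ⟨c, r, hr, hrR, hx, hav⟩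
    obtain ⟨b, hb, ⟨y, hy1, hy2⟩, hle⟩ := hcov (c, r) ⟨hr, hrR, hav⟩
    have hb0 := (hST hb).1
    simp only [B, Metric.mem_ball] at hy1 hy2 hx hle
    refine Set.mem_biUnion hb (Metric.mem_ball.2 ?_)
    have h1 := dist_triangle x c b.1
    have h2 := dist_triangle c y b.1
    rw [dist_comm c y] at h2
    linarith
  calc _ ≤ l * ∑' i : S, μ (Metric.ball i.1.1 (8 * i.1.2)) := by
        gcongr
        exact (measure_mono hsub).trans (measure_biUnion_le μ hcount _)
    _ = ∑' i : S, l * μ (Metric.ball i.1.1 (8 * i.1.2)) := ENNReal.tsum_mul_left.symm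
    _ ≤ ∑' i : S, K * ∫⁻ z in B i, v z ∂μ := by
        refine ENNReal.tsum_le_tsum fun i => ?_
        calc _ ≤ l * (K * μ (B i)) := by
              gcongr
              exact hK _ _ (hST i.2).1
          _ = K * (l * μ (B i)) := mul_left_comm _ _ _
          _ ≤ _ := by
              gcongr
              exact (hST i.2).2.2
    _ = K * ∫⁻ z in ⋃ i ∈ S, B i, v z ∂μ := by
        rw [ENNReal.tsum_mul_left,
          lintegral_biUnion hcount (fun i _ => Metric.isOpen_ball.measurableSet) hdisj]
    _ ≤ _ := by
        gcongr
        exact Measure.restrict_le_self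

/-- The weak type `(1, 1)` estimate for the non-centered maximal operator. -/
theorem mul_measure_maximal_le (hpos : ∀ (x : P) (r : ℝ), 0 < r → 0 < μ (Metric.ball x r))
    (hK : ∀ (x : P) (r : ℝ), 0 < r → μ (Metric.ball x (8 * r)) ≤ K * μ (Metric.ball x r))
    (v : P → ℝ≥0∞) (l : ℝ≥0∞) :
    l * μ {x | ∃ c r, 0 < r ∧ x ∈ Metric.ball c r ∧
      l * μ (Metric.ball c r) ≤ ∫⁻ z in Metric.ball c r, v z ∂μ} ≤ K * ∫⁻ z, v z ∂μ := by
  let W : ℕ → Set P := fun n => {x | ∃ (c : P) (r : ℝ), 0 < r ∧ r ≤ n ∧ x ∈ Metric.ball c r ∧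
      l * μ (Metric.ball c r) ≤ ∫⁻ z in Metric.ball c r, v z ∂μ}
  have hW : Monotone W := by
    rintro m n hmn x ⟨c, r, hr, hrm, h⟩
    exact ⟨c, r, hr, hrm.trans (Nat.cast_le.2 hmn), h⟩
  have hsub : {x | ∃ c r, 0 < r ∧ x ∈ Metric.ball c r ∧
      l * μ (Metric.ball c r) ≤ ∫⁻ z in Metric.ball c r, v z ∂μ} ⊆ ⋃ n, W n := by
    rintro x ⟨c, r, hr, h⟩
    obtain ⟨n, hn⟩ := exists_nat_ge r
    exact Set.mem_iUnion.2 ⟨n, c, r, hr, hn, h⟩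
  calc _ ≤ l * ⨆ n, μ (W n) := by
        gcongr
        exact (measure_mono hsub).trans_eq hW.measure_iUnion
    _ = ⨆ n, l * μ (W n) := ENNReal.mul_iSup ..
    _ ≤ _ := iSup_le fun n => mul_measure_bounded_radius_le hpos hK v l n

/-- The Herz-type estimate `(M_p u)^* ≤ C A_p u^*`. -/
theorem rearr_maximalFn_le
    (hball : ∀ (x : P) (r : ℝ), 0 < r → 0 < μ (Metric.ball x r) ∧ μ (Metric.ball x r) < ⊤)
    (hK : ∀ (x : P) (r : ℝ), 0 < r → μ (Metric.ball x (8 * r)) ≤ K * μ (Metric.ball x r))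
    (hK0 : K ≠ 0) (hKtop : K ≠ ⊤) {p : ℝ} (hp : 1 ≤ p) {u : P → ℝ≥0∞} (hu : Measurable u)
    {t : ℝ} (ht : 0 < t) :
    rearr μ (maximalFn μ p u) t ≤ (1 + K) * Ap p (rearr μ u) t := by
  have hp0 : 0 < p := one_pos.trans_le hp
  have ht0 : ENNReal.ofReal t ≠ 0 := by simpa using ht
  set I := ∫⁻ s in Set.Ioo (0 : ℝ) t, rearr μ u s ^ p
  set D := (ENNReal.ofReal t)⁻¹ * I with hD
  have hA : Ap p (rearr μ u) t = D ^ (1 / p) := rfl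
  have hAp : Ap p (rearr μ u) t ^ p = D := by
    rw [hA, ← ENNReal.rpow_mul, one_div_mul_cancel hp0.ne', ENNReal.rpow_one]
  have hID : I = ENNReal.ofReal t * D := by
    rw [hD, ← mul_assoc, ENNReal.mul_inv_cancel ht0 ENNReal.ofReal_ne_top, one_mul]
  by_cases hDtop : D = ⊤
  · rw [hA, hDtop, ENNReal.top_rpow_of_pos (by positivity), ENNReal.mul_top (by simp)]
    exact le_top
  set a := rearr μ u t
  have haD : a ^ p ≤ D := by
    have h : ENNReal.ofReal t * a ^ p ≤ I := by
      calc ENNReal.ofReal t * a ^ p = ∫⁻ _ in Set.Ioo (0 : ℝ) t, a ^ p := by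
            simp [mul_comm]
        _ ≤ I := setLIntegral_mono' measurableSet_Ioo fun s hs => by
            gcongr
            exact rearr_antitone μ u hs.2.le
    rw [hID] at h
    exact (ENNReal.mul_le_mul_iff_right ht0 ENNReal.ofReal_ne_top).1 h
  set v : P → ℝ≥0∞ := {x | a < u x}.indicator fun x => u x ^ p with hv
  have hvI : ∫⁻ z, v z ∂μ ≤ I :=
    lintegral_indicator_rpow_le_lintegral_rearr hp0 hu (rearr_le_iff.1 le_rfl)
  have huv (z : P) : u z ^ p ≤ a ^ p + v z := by
    by_cases hz : a < u z
    · rw [hv, Set.indicator_of_mem (show z ∈ {x | a < u x} from hz)]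
      exact le_add_self
    · exact (ENNReal.rpow_le_rpow (not_lt.1 hz) hp0.le).trans le_self_add
  have hlarge {x : P} (hx : (1 + K) * Ap p (rearr μ u) t < maximalFn μ p u x) :
      ∃ c r, 0 < r ∧ x ∈ Metric.ball c r ∧
        K * D * μ (Metric.ball c r) < ∫⁻ z in Metric.ball c r, v z ∂μ := by
    simp only [maximalFn, lt_iSup_iff] at hx
    obtain ⟨c, r, hr, hxB, hlt⟩ := hx
    obtain ⟨hB0, hBtop⟩ := hball c r hr
    refine ⟨c, r, hr, hxB, ?_⟩
    set m := μ (Metric.ball c r)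
    have h1 : (1 + K) * D < m⁻¹ * ∫⁻ z in Metric.ball c r, u z ^ p ∂μ := by
      rw [one_div, ENNReal.lt_rpow_inv_iff hp0, ENNReal.mul_rpow_of_nonneg _ _ hp0.le, hAp] at hlt
      refine lt_of_le_of_lt ?_ hlt
      gcongr
      exact ENNReal.le_rpow_self_of_one_le le_self_add hp
    have h2 : (1 + K) * D * m < ∫⁻ z in Metric.ball c r, u z ^ p ∂μ := by
      rwa [mul_comm m⁻¹, ← div_eq_mul_inv,
        ENNReal.lt_div_iff_mul_lt (.inl hB0.ne') (.inl hBtop.ne)] at h1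
    have h3 : ∫⁻ z in Metric.ball c r, u z ^ p ∂μ ≤
        D * m + ∫⁻ z in Metric.ball c r, v z ∂μ := by
      calc _ ≤ ∫⁻ z in Metric.ball c r, (a ^ p + v z) ∂μ := lintegral_mono huv
        _ = a ^ p * m + ∫⁻ z in Metric.ball c r, v z ∂μ := by
          rw [lintegral_add_left measurable_const, setLIntegral_const]
        _ ≤ _ := by gcongr
    have h4 := h2.trans_le h3
    rw [add_mul, add_mul, one_mul] at h4
    exact lt_of_add_lt_add_left h4
  rw [rearr_le_iff]
  by_cases hD0 : D = 0
  · have hempty : {x | (1 + K) * Ap p (rearr μ u) t < maximalFn μ p u x} = ∅ := by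
      refine Set.eq_empty_of_forall_notMem fun x hx => ?_
      obtain ⟨c, r, -, -, h⟩ := hlarge hx
      have hv0 : ∫⁻ z in Metric.ball c r, v z ∂μ ≤ 0 := by
        calc _ ≤ ∫⁻ z, v z ∂μ := setLIntegral_le_lintegral _ _
          _ ≤ I := hvI
          _ = 0 := by rw [hID, hD0, mul_zero]
      exact absurd (h.trans_le hv0) not_lt_zero
    rw [hempty, measure_empty]
    exact zero_le
  · have hweak := mul_measure_maximal_le (fun x r hr => (hball x r hr).1) hK v (K * D)
    have hle : K * D * μ {x | (1 + K) * Ap p (rearr μ u) t < maximalFn μ p u x} ≤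
        K * D * ENNReal.ofReal t := by
      calc _ ≤ K * D * μ {x | ∃ c r, 0 < r ∧ x ∈ Metric.ball c r ∧
            K * D * μ (Metric.ball c r) ≤ ∫⁻ z in Metric.ball c r, v z ∂μ} := by
            gcongr with x
            intro hx
            obtain ⟨c, r, hr, hxB, h⟩ := hlarge hx
            exact ⟨c, r, hr, hxB, h.le⟩
        _ ≤ K * ∫⁻ z, v z ∂μ := hweak
        _ ≤ K * I := by gcongr
        _ = _ := by rw [hID]; ring
    exact (ENNReal.mul_le_mul_iff_right (mul_ne_zero hK0 hD0)
      (ENNReal.mul_ne_top hKtop hDtop)).1 hle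

end WeakType

/-- Quasi-concavity bounds the growth of `φ` beyond `1 / 2`. -/
theorem QuasiConcave.le_two_mul {φ : ℝ → ℝ} (hφ : QuasiConcave φ) {t : ℝ} (ht : 1 / 2 ≤ t) :
    φ t ≤ 2 * t * φ (1 / 2) := by
  have ht0 : 0 < t := by linarith
  have h := hφ.2.2.2 (Set.mem_Ioi.2 (by norm_num : (0 : ℝ) < 1 / 2)) (Set.mem_Ioi.2 ht0) ht
  simp only at h
  rw [div_le_iff₀ ht0] at h
  linarith


/-- **Boundedness of `M_p` from `M^p_{φ,loc}` to `M^*_φ` on sets of finite measure:**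
on any metric measure space with a σ-finite Borel regular doubling measure giving balls
finite positive measure, for any `p ∈ [1,∞)` and quasi-concave `φ`, there is `C > 0`
depending only on the doubling constant and `p` such that for all measurable `u` and all
measurable `E` of finite measure,
`sup_{t>0} ((M_p u)·χ_E)*(t) φ(t) ≤ C (1 + μ E) · sup_{0<t<1} A_p u*(t) φ(t)`. -/
theorem maximal_bounded_MpLoc_to_weakMarcinkiewicz_fm (Cd : ℝ≥0) (hCd : 1 ≤ Cd)
    (p : ℝ) (hp : 1 ≤ p) :
    ∃ C : ℝ, 0 < C ∧
      ∀ (P : Type) [MetricSpace P] [MeasurableSpace P] [BorelSpace P]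
        (μ : Measure P), SigmaFinite μ →
        (∀ (x : P) (r : ℝ), 0 < r →
          0 < μ (Metric.ball x r) ∧ μ (Metric.ball x r) < ⊤) →
        (∀ (x : P) (r : ℝ), 0 < r →
          μ (Metric.ball x (2 * r)) ≤ (Cd : ℝ≥0∞) * μ (Metric.ball x r)) →
        ∀ φ : ℝ → ℝ, QuasiConcave φ →
        ∀ u : P → ℝ≥0∞, Measurable u →
        ∀ E : Set P, MeasurableSet E → μ E < ⊤ →
          (⨆ t ∈ Set.Ioi (0 : ℝ),
              rearr μ (E.indicator (maximalFn μ p u)) t * ENNReal.ofReal (φ t)) ≤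
            ENNReal.ofReal C * (1 + μ E) *
              ⨆ t ∈ Set.Ioo (0 : ℝ) 1, Ap p (rearr μ u) t * ENNReal.ofReal (φ t) := by
  refine ⟨2 * (1 + (Cd : ℝ) ^ 3), by positivity, ?_⟩
  intro P _ _ _ μ _ hball hdouble φ hφ u hu E _ hE
  set K : ℝ≥0∞ := (Cd : ℝ≥0∞) ^ 3 with hKdef
  have hC : ENNReal.ofReal (2 * (1 + (Cd : ℝ) ^ 3)) = 2 * (1 + K) := by
    have : (2 * (1 + (Cd : ℝ) ^ 3)) = ((2 * (1 + Cd ^ 3) : ℝ≥0) : ℝ) := by push_cast; rfl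
    rw [this, ENNReal.ofReal_coe_nnreal, hKdef]
    push_cast
    rfl
  have hK (x : P) (r : ℝ) (hr : 0 < r) :
      μ (Metric.ball x (8 * r)) ≤ K * μ (Metric.ball x r) := by
    calc μ (Metric.ball x (8 * r)) = μ (Metric.ball x (2 * (2 * (2 * r)))) := by ring_nf
      _ ≤ Cd * (Cd * (Cd * μ (Metric.ball x r))) := by
        refine (hdouble x _ (by positivity)).trans ?_
        gcongr
        refine (hdouble x _ (by positivity)).trans ?_
        gcongr
        exact hdouble x r hr
      _ = _ := by rw [hKdef]; ring
  have hCd0 : (Cd : ℝ≥0∞) ≠ 0 := by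
    exact_mod_cast (one_pos.trans_le hCd).ne'
  have hherz {t : ℝ} (ht : 0 < t) :
      rearr μ (maximalFn μ p u) t ≤ (1 + K) * Ap p (rearr μ u) t :=
    rearr_maximalFn_le hball hK (pow_ne_zero _ hCd0) (ENNReal.pow_ne_top ENNReal.coe_ne_top)
      hp hu ht
  set S := ⨆ t ∈ Set.Ioo (0 : ℝ) 1, Ap p (rearr μ u) t * ENNReal.ofReal (φ t)
  have hle {t : ℝ} (ht : t ∈ Set.Ioo (0 : ℝ) 1) :
      Ap p (rearr μ u) t * ENNReal.ofReal (φ t) ≤ S :=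
    le_iSup₂ (f := fun t (_ : t ∈ Set.Ioo (0 : ℝ) 1) =>
      Ap p (rearr μ u) t * ENNReal.ofReal (φ t)) t ht
  have hind (t : ℝ) :
      rearr μ (E.indicator (maximalFn μ p u)) t ≤ rearr μ (maximalFn μ p u) t :=
    rearr_mono μ (Set.indicator_le_self _ _) t
  rw [hC]
  refine iSup₂_le fun t ht => ?_
  rcases lt_or_ge t 1 with ht1 | ht1
  · calc _ ≤ (1 + K) * Ap p (rearr μ u) t * ENNReal.ofReal (φ t) := by
          gcongr
          exact (hind t).trans (hherz ht)
      _ ≤ (1 + K) * S := by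
          rw [mul_assoc]
          gcongr
          exact hle ⟨ht, ht1⟩
      _ ≤ 2 * (1 + K) * (1 + μ E) * S := by
          gcongr
          calc 1 + K = 1 * (1 + K) * 1 := by ring
            _ ≤ _ := by
              gcongr
              · exact one_le_two
              · exact le_self_add
  · rcases le_or_gt (μ E) (ENNReal.ofReal t) with hEt | hEt
    · rw [rearr_indicator_eq_zero _ hEt, zero_mul]
      exact zero_le
    · have hhalf : (1 / 2 : ℝ) ∈ Set.Ioo (0 : ℝ) 1 := by norm_num
      have hφt : ENNReal.ofReal (φ t) ≤ 2 * μ E * ENNReal.ofReal (φ (1 / 2)) := by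
        calc _ ≤ ENNReal.ofReal (2 * t * φ (1 / 2)) :=
              ENNReal.ofReal_le_ofReal (hφ.le_two_mul (by linarith))
          _ = 2 * ENNReal.ofReal t * ENNReal.ofReal (φ (1 / 2)) := by
              have ht0 : (0 : ℝ) ≤ t := le_of_lt ht
              rw [ENNReal.ofReal_mul (by positivity), ENNReal.ofReal_mul zero_le_two]
              simp
          _ ≤ _ := by gcongr
      calc _ ≤ (1 + K) * Ap p (rearr μ u) (1 / 2) *
            (2 * μ E * ENNReal.ofReal (φ (1 / 2))) := by
            gcongr
            exact ((hind t).trans (rearr_antitone μ _ (by linarith))).trans (hherz hhalf.1)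
        _ = 2 * (1 + K) * μ E * (Ap p (rearr μ u) (1 / 2) * ENNReal.ofReal (φ (1 / 2))) := by
            ring
        _ ≤ _ := by
            gcongr
            · exact le_add_self
            · exact hle hhalf
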